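/- Let ψ : ℝ → ℝ be integrable with integrable Fourier transform ψ̂, and assume ψ̂ is not almost everywhere zero. Let n ≥ 1 and let t₁, …, t_n ∈ ℝ be pairwise distinct. Define the real 2n × 2n matrix Ψ by: Ψ(2k−1, 2k′−1) = Ψ(2k, 2k′) = ∫₀^∞ cos((t_k − t_{k′})u) |ψ̂(u)|² du, Ψ(2k−1, 2k′) = ∫₀^∞ sin((t_k − t_{k′})u) |ψ̂(u)|² du, and Ψ(2k, 2k′−1) = ∫₀^∞ sin((t_{k′} − t_k)u) |ψ̂(u)|² du, for k, k′ ∈ {1, …, n}. Then Ψ is a symmetric positive definite matrix. -/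

import Mathlib

open MeasureTheory Set

/-- The Fourier transform `ψ̂(λ) = ∫ e^{-iuλ} ψ(u) du` of an integrable `ψ : ℝ → ℝ`. -/
noncomputable def Fhat (ψ : ℝ → ℝ) (l : ℝ) : ℂ :=
  ∫ u : ℝ, Complex.exp (-Complex.I * u * l) * (ψ u : ℂ)

/-- The `2n × 2n` matrix `Ψ` of Theorem 2, indexed by `Fin n × Fin 2`, where the
index `(k, 0)` plays the role of `2k−1` and `(k, 1)` the role of `2k`:
`Ψ(2k−1,2k′−1) = Ψ(2k,2k′) = ∫₀^∞ cos((t_k−t_{k′})u)|ψ̂(u)|² du`,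
`Ψ(2k−1,2k′) = ∫₀^∞ sin((t_k−t_{k′})u)|ψ̂(u)|² du`,
`Ψ(2k,2k′−1) = ∫₀^∞ sin((t_{k′}−t_k)u)|ψ̂(u)|² du`. -/
noncomputable def PsiMat (ψ : ℝ → ℝ) {n : ℕ} (t : Fin n → ℝ) :
    Matrix (Fin n × Fin 2) (Fin n × Fin 2) ℝ := fun p q =>
  if p.2 = q.2 then
    ∫ u in Set.Ioi (0 : ℝ), Real.cos ((t p.1 - t q.1) * u) * ‖Fhat ψ u‖ ^ 2
  else if p.2 = 0 then
    ∫ u in Set.Ioi (0 : ℝ), Real.sin ((t p.1 - t q.1) * u) * ‖Fhat ψ u‖ ^ 2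
  else
    ∫ u in Set.Ioi (0 : ℝ), Real.sin ((t q.1 - t p.1) * u) * ‖Fhat ψ u‖ ^ 2

/-- The real (`cos`, `-sin`) coordinates of the trigonometric vectors whose Gram matrix is `Ψ`. -/
noncomputable def gramCos {n : ℕ} (t : Fin n → ℝ) (p : Fin n × Fin 2) (u : ℝ) : ℝ :=
  if p.2 = 0 then Real.cos (t p.1 * u) else -Real.sin (t p.1 * u)

/-- The imaginary (`sin`, `cos`) coordinates of the trigonometric vectors whose Gram matrix
is `Ψ`. -/
noncomputable def gramSin {n : ℕ} (t : Fin n → ℝ) (p : Fin n × Fin 2) (u : ℝ) : ℝ :=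
  if p.2 = 0 then Real.sin (t p.1 * u) else Real.cos (t p.1 * u)

lemma continuous_gramCos {n : ℕ} (t : Fin n → ℝ) (p : Fin n × Fin 2) :
    Continuous (gramCos t p) := by
  unfold gramCos; split_ifs <;> fun_prop

lemma continuous_gramSin {n : ℕ} (t : Fin n → ℝ) (p : Fin n × Fin 2) :
    Continuous (gramSin t p) := by
  unfold gramSin; split_ifs <;> fun_prop

lemma abs_gramCos_le_one {n : ℕ} (t : Fin n → ℝ) (p : Fin n × Fin 2) (u : ℝ) :
    |gramCos t p u| ≤ 1 := by
  unfold gramCos; split_ifs <;> simp [Real.abs_cos_le_one, Real.abs_sin_le_one]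

lemma abs_gramSin_le_one {n : ℕ} (t : Fin n → ℝ) (p : Fin n × Fin 2) (u : ℝ) :
    |gramSin t p u| ≤ 1 := by
  unfold gramSin; split_ifs <;> simp [Real.abs_cos_le_one, Real.abs_sin_le_one]

lemma PsiMat_eq_gram (ψ : ℝ → ℝ) {n : ℕ} (t : Fin n → ℝ) (p q : Fin n × Fin 2) :
    PsiMat ψ t p q = ∫ u in Ioi (0 : ℝ),
      (gramCos t p u * gramCos t q u + gramSin t p u * gramSin t q u) * ‖Fhat ψ u‖ ^ 2 := by
  obtain ⟨k, i⟩ := p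
  obtain ⟨l, j⟩ := q
  fin_cases i <;> fin_cases j <;>
    simp [PsiMat, gramCos, gramSin, sub_mul, Real.cos_sub, Real.sin_sub] <;>
    refine integral_congr_ae (.of_forall fun u ↦ ?_) <;> dsimp only <;> ring

lemma isSymm_PsiMat (ψ : ℝ → ℝ) {n : ℕ} (t : Fin n → ℝ) : (PsiMat ψ t).IsSymm := by
  ext p q
  simp only [Matrix.transpose_apply, PsiMat_eq_gram]
  congr! 3
  ring

lemma norm_exp_neg_I_mul_mul (u l : ℝ) : ‖Complex.exp (-Complex.I * u * l)‖ = 1 := by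
  simp [Complex.norm_exp]

lemma continuous_Fhat {ψ : ℝ → ℝ} (hψ : Integrable ψ) : Continuous (Fhat ψ) := by
  refine continuous_of_dominated (bound := fun u ↦ ‖ψ u‖) ?_ ?_ hψ.norm ?_
  · intro l
    exact (by fun_prop : Continuous fun u : ℝ ↦ Complex.exp (-Complex.I * u * l))
      |>.aestronglyMeasurable.mul hψ.ofReal.aestronglyMeasurable
  · intro l
    filter_upwards with u
    rw [norm_mul, norm_exp_neg_I_mul_mul, one_mul, Complex.norm_real]
  · filter_upwards with u
    fun_prop

lemma norm_Fhat_le (ψ : ℝ → ℝ) (l : ℝ) : ‖Fhat ψ l‖ ≤ ∫ u, ‖ψ u‖ := by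
  refine (norm_integral_le_integral_norm _).trans_eq ?_
  simp_rw [norm_mul, norm_exp_neg_I_mul_mul, one_mul, Complex.norm_real]

lemma Fhat_neg (ψ : ℝ → ℝ) (l : ℝ) : Fhat ψ (-l) = (starRingEnd ℂ) (Fhat ψ l) := by
  unfold Fhat
  rw [← integral_conj]
  congr! 2 with u
  simp [← Complex.exp_conj]

lemma integrable_norm_Fhat_sq {ψ : ℝ → ℝ} (hψ : Integrable ψ) (hψhat : Integrable (Fhat ψ)) :
    Integrable fun u ↦ ‖Fhat ψ u‖ ^ 2 := by
  simp_rw [sq]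
  refine hψhat.norm.bdd_mul (c := ∫ u, ‖ψ u‖)
    (continuous_Fhat hψ).norm.aestronglyMeasurable ?_
  filter_upwards with u
  simpa using norm_Fhat_le ψ u

lemma exists_pos_Fhat_ne_zero {ψ : ℝ → ℝ} (hne : ¬ ∀ᵐ l : ℝ, Fhat ψ l = 0) :
    ∃ l : ℝ, 0 < l ∧ Fhat ψ l ≠ 0 := by
  by_contra! h
  refine hne ?_
  filter_upwards [Measure.ae_ne volume (0 : ℝ)] with l hl
  rcases hl.lt_or_gt with hl | hl
  · simpa [Fhat_neg] using h (-l) (by linarith)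
  · exact h l hl

/-- The trigonometric polynomial with complex coefficients `x (k, 0) + i x (k, 1)` and
frequencies `t k`. -/
noncomputable def trigPoly {n : ℕ} (t : Fin n → ℝ) (x : Fin n × Fin 2 → ℝ) (u : ℝ) : ℂ :=
  ∑ k, (x (k, 0) + x (k, 1) * Complex.I) * Complex.exp (Complex.I * t k * u)

lemma trigPoly_eq {n : ℕ} (t : Fin n → ℝ) (x : Fin n × Fin 2 → ℝ) (u : ℝ) :
    trigPoly t x u =
      (∑ p, x p * gramCos t p u : ℝ) + (∑ p, x p * gramSin t p u : ℝ) * Complex.I := by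
  simp only [trigPoly, Fintype.sum_prod_type, Fin.sum_univ_two, gramCos, gramSin]
  push_cast
  rw [Finset.sum_mul, ← Finset.sum_add_distrib]
  refine Finset.sum_congr rfl fun k _ ↦ ?_
  rw [show Complex.I * t k * u = ((t k * u : ℝ) : ℂ) * Complex.I by push_cast; ring,
    Complex.exp_mul_I]
  simp
  linear_combination (x (k, 1) * Complex.sin (t k * u)) * Complex.I_sq

lemma norm_trigPoly_sq {n : ℕ} (t : Fin n → ℝ) (x : Fin n × Fin 2 → ℝ) (u : ℝ) :
    ‖trigPoly t x u‖ ^ 2 = ∑ p, ∑ q,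
      x p * x q * (gramCos t p u * gramCos t q u + gramSin t p u * gramSin t q u) := by
  rw [trigPoly_eq, Complex.sq_norm, Complex.normSq_add_mul_I, sq, sq, Finset.sum_mul_sum,
    Finset.sum_mul_sum, ← Finset.sum_add_distrib]
  refine Finset.sum_congr rfl fun p _ ↦ ?_
  rw [← Finset.sum_add_distrib]
  refine Finset.sum_congr rfl fun q _ ↦ ?_
  ring

lemma dotProduct_PsiMat_mulVec {ψ : ℝ → ℝ} (hw : Integrable fun u ↦ ‖Fhat ψ u‖ ^ 2) {n : ℕ}
    (t : Fin n → ℝ) (x : Fin n × Fin 2 → ℝ) :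
    x ⬝ᵥ (PsiMat ψ t).mulVec x =
      ∫ u in Ioi (0 : ℝ), ‖trigPoly t x u‖ ^ 2 * ‖Fhat ψ u‖ ^ 2 := by
  have hint (p q : Fin n × Fin 2) : IntegrableOn (fun u ↦ x p * x q *
      ((gramCos t p u * gramCos t q u + gramSin t p u * gramSin t q u) * ‖Fhat ψ u‖ ^ 2))
      (Ioi 0) := by
    refine ((hw.bdd_mul (c := 2) ?_ ?_).const_mul _).integrableOn
    · have := continuous_gramCos t
      have := continuous_gramSin t
      exact Continuous.aestronglyMeasurable (by fun_prop)
    · filter_upwards with u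
      calc |gramCos t p u * gramCos t q u + gramSin t p u * gramSin t q u|
          ≤ |gramCos t p u| * |gramCos t q u| + |gramSin t p u| * |gramSin t q u| := by
            simpa only [abs_mul] using
              abs_add_le (gramCos t p u * gramCos t q u) (gramSin t p u * gramSin t q u)
        _ ≤ 1 * 1 + 1 * 1 := by
            gcongr <;> first | apply abs_gramCos_le_one | apply abs_gramSin_le_one
        _ = 2 := by norm_num
  simp only [norm_trigPoly_sq, Finset.sum_mul, mul_assoc (_ * _ : ℝ)]
  rw [integral_finsetSum _ fun p _ ↦ integrable_finsetSum _ fun q _ ↦ hint p q]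
  refine Finset.sum_congr rfl fun p _ ↦ ?_
  rw [integral_finsetSum _ fun q _ ↦ hint p q, Matrix.mulVec, dotProduct, Finset.mul_sum]
  refine Finset.sum_congr rfl fun q _ ↦ ?_
  rw [integral_const_mul, PsiMat_eq_gram]
  ring

lemma analyticOnNhd_trigPoly {n : ℕ} (t : Fin n → ℝ) (x : Fin n × Fin 2 → ℝ) :
    AnalyticOnNhd ℝ (trigPoly t x) univ := by
  intro u _
  unfold trigPoly
  have : AnalyticAt ℝ (fun u : ℝ ↦ (u : ℂ)) u := Complex.ofRealCLM.analyticAt u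
  refine Finset.analyticAt_fun_sum _ fun k _ ↦ ?_
  refine analyticAt_const.mul ?_
  exact (analyticAt_cexp.restrictScalars (𝕜 := ℝ)).comp (analyticAt_const.mul this)

/-- The character `u ↦ e^{isu}` of the additive group of the reals. -/
noncomputable def expChar (s : ℝ) : Multiplicative ℝ →* ℂ where
  toFun u := Complex.exp (Complex.I * s * (u.toAdd : ℝ))
  map_one' := by simp
  map_mul' u v := by
    rw [← Complex.exp_add, toAdd_mul]
    push_cast
    ring_nf

lemma expChar_injective : Function.Injective expChar := by
  intro s r h
  have hd (a : ℝ) : HasDerivAt (fun u : ℝ ↦ Complex.exp (Complex.I * a * u)) (Complex.I * a) 0 := by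
    simpa using ((Complex.ofRealCLM.hasDerivAt (x := (0 : ℝ))).const_mul (Complex.I * a)).cexp
  have hf : (fun u : ℝ ↦ Complex.exp (Complex.I * s * u)) =
      fun u : ℝ ↦ Complex.exp (Complex.I * r * u) :=
    funext fun u ↦ DFunLike.congr_fun h (Multiplicative.ofAdd u)
  have := (hd s).unique (hf ▸ hd r)
  simpa using this

lemma eq_zero_of_trigPoly_eq_zero {n : ℕ} {t : Fin n → ℝ} (ht : Function.Injective t)
    {x : Fin n × Fin 2 → ℝ} (h : ∀ u, trigPoly t x u = 0) : x = 0 := by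
  have hli := (linearIndependent_monoidHom (Multiplicative ℝ) ℂ).comp _
    (expChar_injective.comp ht)
  rw [Fintype.linearIndependent_iff] at hli
  have hc := hli (fun k ↦ x (k, 0) + x (k, 1) * Complex.I) <| by
    ext u
    simpa [trigPoly, expChar] using h u.toAdd
  ext ⟨k, i⟩
  have hk := Complex.ext_iff.1 (hc k)
  fin_cases i
  · simpa using hk.1
  · simpa using hk.2

lemma posDef_PsiMat {ψ : ℝ → ℝ} (hψ : Integrable ψ) (hψhat : Integrable (Fhat ψ))
    (hne : ¬ ∀ᵐ l : ℝ, Fhat ψ l = 0) {n : ℕ} {t : Fin n → ℝ} (ht : Function.Injective t) :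
    (PsiMat ψ t).PosDef := by
  have hw := integrable_norm_Fhat_sq hψ hψhat
  refine Matrix.PosDef.of_dotProduct_mulVec_pos ?_ fun x hx ↦ ?_
  · rw [Matrix.IsHermitian, Matrix.conjTranspose_eq_transpose_of_trivial]
    exact isSymm_PsiMat ψ t
  rw [star_trivial, dotProduct_PsiMat_mulVec hw]
  have hcont : Continuous (trigPoly t x) :=
    continuousOn_univ.1 (analyticOnNhd_trigPoly t x).continuousOn
  have hprod : Continuous fun u ↦ ‖trigPoly t x u‖ ^ 2 * ‖Fhat ψ u‖ ^ 2 :=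
    (hcont.norm.pow 2).mul ((continuous_Fhat hψ).norm.pow 2)
  obtain ⟨l, hl, hFl⟩ := exists_pos_Fhat_ne_zero hne
  obtain ⟨u, hu, hTu, hFu⟩ : ∃ u : ℝ, 0 < u ∧ trigPoly t x u ≠ 0 ∧ Fhat ψ u ≠ 0 := by
    by_contra! h
    refine hx (eq_zero_of_trigPoly_eq_zero ht fun u ↦ ?_)
    refine (analyticOnNhd_trigPoly t x).eqOn_zero_of_preconnected_of_eventuallyEq_zero
      isPreconnected_univ (mem_univ l) ?_ (mem_univ u)
    filter_upwards [lt_mem_nhds hl, (continuous_Fhat hψ).continuousAt.eventually_ne hFl]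
      with v hv hFv
    by_contra hTv
    exact hFv (h v hv hTv)
  obtain ⟨C, hC⟩ : ∃ C, ∀ v, ‖‖trigPoly t x v‖ ^ 2‖ ≤ C := by
    refine ⟨(∑ k, ‖(x (k, 0) + x (k, 1) * Complex.I : ℂ)‖) ^ 2, fun v ↦ ?_⟩
    rw [norm_pow, norm_norm]
    gcongr
    refine (norm_sum_le _ _).trans_eq ?_
    simp [Complex.norm_exp]
  rw [setIntegral_pos_iff_support_of_nonneg_ae]
  · refine IsOpen.measure_pos _ (hprod.isOpen_support.inter isOpen_Ioi) ⟨u, ?_, hu⟩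
    simp [hTu, hFu]
  · filter_upwards with v
    simp only [Pi.zero_apply]
    positivity
  · exact (hw.bdd_mul (hcont.norm.pow 2).aestronglyMeasurable
      (Filter.Eventually.of_forall hC)).integrableOn

/-- If `ψ, ψ̂ ∈ L¹`, `ψ̂` is not almost everywhere zero, and `t₁, …, t_n` are
pairwise distinct, then the matrix `Ψ` is symmetric positive definite. -/
theorem stmt10 (ψ : ℝ → ℝ) (hψ : Integrable ψ) (hψhat : Integrable (Fhat ψ))
    (hne : ¬ (∀ᵐ l : ℝ, Fhat ψ l = 0))
    (n : ℕ) (hn : 1 ≤ n) (t : Fin n → ℝ) (ht : Function.Injective t) :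
    (PsiMat ψ t).IsSymm ∧ (PsiMat ψ t).PosDef := by
  exact ⟨isSymm_PsiMat ψ t, posDef_PsiMat hψ hψhat hne ht⟩
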